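/- Fix k and let F be an unsatisfiable linear [l,k]-CNF formula with 2 ≤ l ≤ k. Then there exists a clause C ∈ F and a partial assignment α defined exactly on the variables of C such that: F^[α] is an [l-1,k]-CNF, d(F^[α]) ≤ d(F) + k, and α satisfies at least ((l-1)/(2l))·(2^{k-2} - k·d(F)·2^{k-l}) clauses of F. -/

import Mathlib

/-- A clause: a finite set of literals, where a literal is a pair of a variable
and a sign (`true` = positive occurrence, `false` = negated occurrence). -/
abbrev Clause (V : Type) : Type := Finset (V × Bool)

/-- A CNF formula: a finite set of clauses. -/
abbrev CNF (V : Type) : Type := Finset (Finset (V × Bool))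

/-- The set of variables occurring (possibly negated) in a clause. -/
def vbl {V : Type} [DecidableEq V] (C : Clause V) : Finset V := C.image Prod.fst

/-- A clause is proper if it does not contain both a variable and its negation. -/
def ProperClause {V : Type} (C : Clause V) : Prop :=
  ∀ x : V, ¬ ((x, true) ∈ C ∧ (x, false) ∈ C)

/-- The literal `(x, b)` evaluates to true under `α` iff `α x = b`;
an assignment satisfies a clause if some literal evaluates to true. -/
def SatClause {V : Type} (α : V → Bool) (C : Clause V) : Prop :=
  ∃ l ∈ C, α l.1 = l.2

instance {V : Type} [DecidableEq V] (α : V → Bool) (C : Clause V) :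
    Decidable (SatClause α C) := by unfold SatClause; infer_instance

/-- An assignment satisfies a formula if it satisfies every clause. -/
def Satisfies {V : Type} (α : V → Bool) (F : CNF V) : Prop :=
  ∀ C ∈ F, SatClause α C

/-- A formula is unsatisfiable if no assignment satisfies it. -/
def Unsat {V : Type} (F : CNF V) : Prop := ∀ α : V → Bool, ¬ Satisfies α F

/-- A `k`-CNF: every clause is proper and has exactly `k` literals. -/
def IsKCNF {V : Type} (k : ℕ) (F : CNF V) : Prop :=
  ∀ C ∈ F, ProperClause C ∧ C.card = k

/-- A CNF is linear if any two distinct clauses share at most one variable. -/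
def LinearCNF {V : Type} [DecidableEq V] (F : CNF V) : Prop :=
  ∀ C ∈ F, ∀ D ∈ F, C ≠ D → (vbl C ∩ vbl D).card ≤ 1

/-- The neighborhood `Γ(C)` of a clause `C` in `F`: the clauses of `F` other than `C`
sharing at least one variable with `C`. -/
def Gamma {V : Type} [DecidableEq V] (F : CNF V) (C : Clause V) : Finset (Clause V) :=
  F.filter fun D => D ≠ C ∧ (vbl D ∩ vbl C).Nonempty

/-- `Γ'(C)`: the neighbors of `C` of size at most `k - 1`. -/
def Gamma' {V : Type} [DecidableEq V] (k : ℕ) (F : CNF V) (C : Clause V) :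
    Finset (Clause V) :=
  (Gamma F C).filter fun D => D.card ≤ k - 1

/-- `d_F(x)`: the number of clauses of `F` of size at most `k - 1` containing the
variable `x`. -/
def degVar {V : Type} [DecidableEq V] (k : ℕ) (F : CNF V) (x : V) : ℕ :=
  (F.filter fun C => x ∈ vbl C ∧ C.card ≤ k - 1).card

/-- `d(F)`: the maximum of `d_F(x)` over all variables `x` of `F`. -/
def degCNF {V : Type} [DecidableEq V] (k : ℕ) (F : CNF V) : ℕ :=
  (F.biUnion vbl).sup (degVar k F)

/-- A partial assignment `α : V → Option Bool` satisfies a clause if some literal of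
the clause evaluates to `1` under `α`. -/
def PSatClause {V : Type} (α : V → Option Bool) (C : Clause V) : Prop :=
  ∃ l ∈ C, α l.1 = some l.2

instance {V : Type} [DecidableEq V] (α : V → Option Bool) (C : Clause V) :
    Decidable (PSatClause α C) := by unfold PSatClause; infer_instance

/-- Applying a partial assignment `α` to `F`: remove every clause satisfied by `α`,
and from the remaining clauses remove all literals evaluating to `0` under `α`.
The result is denoted `F^[α]` in the paper. -/
def applyAssign {V : Type} [DecidableEq V] (α : V → Option Bool) (F : CNF V) : CNF V :=
  (F.filter fun D => ¬ PSatClause α D).image fun D =>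
    D.filter fun l => α l.1 ≠ some (!l.2)

open Finset

lemma fst_injOn_of_properClause {V : Type} {C : Clause V} (hC : ProperClause C) :
    Set.InjOn Prod.fst (C : Set (V × Bool)) := by
  rintro ⟨x, b⟩ hb ⟨y, c⟩ hc h
  obtain rfl : x = y := h
  have := hC x
  cases b <;> cases c <;> simp_all

section Models

variable {V : Type} [DecidableEq V]

lemma card_vbl {C : Clause V} (hC : ProperClause C) : (vbl C).card = C.card :=
  card_image_of_injOn (fst_injOn_of_properClause hC)

/-- The sets of true variables, within `U`, of the assignments that satisfy `S`. -/
noncomputable def models (U : Finset V) (S : CNF V) : Finset (Finset V) :=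
  open Classical in U.powerset.filter fun A => Satisfies (fun x => decide (x ∈ A)) S

/-- The models of `S` that violate the clause `C`. -/
noncomputable def violating (U : Finset V) (S : CNF V) (C : Clause V) : Finset (Finset V) :=
  (models U S).filter fun A => ¬ SatClause (fun x => decide (x ∈ A)) C

lemma mem_models {U A : Finset V} {S : CNF V} :
    A ∈ models U S ↔ A ⊆ U ∧ Satisfies (fun x => decide (x ∈ A)) S := by
  simp [models]

lemma mem_violating {U A : Finset V} {S : CNF V} {C : Clause V} :
    A ∈ violating U S C ↔ A ∈ models U S ∧ ¬ SatClause (fun x => decide (x ∈ A)) C := by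
  simp [violating]

lemma satClause_congr {α β : V → Bool} {C : Clause V} (h : ∀ x ∈ vbl C, α x = β x) :
    SatClause α C ↔ SatClause β C := by
  unfold SatClause
  refine exists_congr fun l => and_congr_right fun hl => ?_
  rw [h _ (mem_image_of_mem _ hl)]

/-- A clause that shares no variable with `S` is violated by a `2^{-|C|}` fraction of the
models of `S`. -/
lemma card_violating_mul_le {U : Finset V} {S : CNF V} {C : Clause V} (hC : ProperClause C)
    (hCU : vbl C ⊆ U) (hdisj : ∀ D ∈ S, Disjoint (vbl D) (vbl C)) :
    (violating U S C).card * 2 ^ C.card ≤ (models U S).card := by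
  rw [← card_vbl hC, ← card_powerset, ← card_product]
  refine card_le_card_of_injOn (fun p => (p.1 \ vbl C) ∪ p.2) ?_ ?_
  · rintro ⟨A, B⟩ h
    simp only [coe_product, Set.mem_prod, mem_coe, mem_violating, mem_models, mem_powerset] at h
    obtain ⟨⟨⟨hAU, hsat⟩, -⟩, hB⟩ := h
    simp only [mem_coe, mem_models]
    refine ⟨union_subset (sdiff_subset.trans hAU) (hB.trans hCU), fun D hD => ?_⟩
    refine (satClause_congr fun x hx => ?_).1 (hsat D hD)
    have hxC := Finset.disjoint_left.1 (hdisj D hD) hx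
    have hxB : x ∉ B := fun h => hxC (hB h)
    simp [hxC, hxB]
  · rintro ⟨A, B⟩ h ⟨A', B'⟩ h' heq
    simp only [coe_product, Set.mem_prod, mem_coe, mem_violating, mem_models, mem_powerset,
      SatClause, not_exists, not_and] at h h'
    obtain ⟨⟨-, hA⟩, hB⟩ := h
    obtain ⟨⟨-, hA'⟩, hB'⟩ := h'
    simp only [Finset.ext_iff, mem_union, mem_sdiff] at heq
    have hAA : A = A' := by
      ext x
      by_cases hx : x ∈ vbl C
      · obtain ⟨⟨y, b⟩, hl, rfl⟩ := mem_image.1 hx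
        have h1 := hA _ hl
        have h2 := hA' _ hl
        cases b <;> simp_all
      · have h1 : x ∉ B := fun h => hx (hB h)
        have h2 : x ∉ B' := fun h => hx (hB' h)
        simpa [hx, h1, h2] using heq x
    have hBB : B = B' := by
      ext x
      by_cases hx : x ∈ vbl C
      · simpa [hx] using heq x
      · exact ⟨fun h => absurd (hB h) hx, fun h => absurd (hB' h) hx⟩
    rw [hAA, hBB]

lemma models_anti {U : Finset V} {S T : CNF V} (h : S ⊆ T) : models U T ⊆ models U S :=
  fun _ hA => mem_models.2 ⟨(mem_models.1 hA).1, fun D hD => (mem_models.1 hA).2 D (h hD)⟩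

lemma violating_anti {U : Finset V} {S T : CNF V} (C : Clause V) (h : S ⊆ T) :
    violating U T C ⊆ violating U S C :=
  filter_subset_filter _ (models_anti h)

lemma models_subset_union {U : Finset V} {S T : CNF V} :
    models U S ⊆ models U T ∪ (T \ S).biUnion (violating U S) := by
  intro A hA
  by_cases h : ∃ D ∈ T, ¬ SatClause (fun x => decide (x ∈ A)) D
  · obtain ⟨D, hD, hAD⟩ := h
    have hDS : D ∉ S := fun h => hAD ((mem_models.1 hA).2 D h)
    exact mem_union_right _ (mem_biUnion.2 ⟨D, mem_sdiff.2 ⟨hD, hDS⟩, mem_violating.2 ⟨hA, hAD⟩⟩)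
  · push Not at h
    exact mem_union_left _ (mem_models.2 ⟨(mem_models.1 hA).1, h⟩)

lemma card_models_le_add_sum {U : Finset V} {S T : CNF V} :
    (models U S).card ≤ (models U T).card + ∑ D ∈ T \ S, (violating U S D).card :=
  (card_le_card models_subset_union).trans <| (card_union_le _ _).trans <| by
    gcongr
    exact card_biUnion_le

lemma card_violating_le {F : CNF V} (hproper : ∀ C ∈ F, ProperClause C)
    (hsum : ∀ C ∈ F, ∑ D ∈ Gamma F C, ((1 : ℝ) / 2) ^ D.card ≤ 1 / 4)
    (S : CNF V) (hS : S ⊆ F) (C : Clause V) (hC : C ∈ F) (hCS : C ∉ S) :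
    ((violating (F.biUnion vbl) S C).card : ℝ) ≤
      2 * (1 / 2) ^ C.card * (models (F.biUnion vbl) S).card := by
  induction S using Finset.strongInduction generalizing C with
  | H S ih =>
    set U := F.biUnion vbl
    set R := S.filter fun D => Disjoint (vbl D) (vbl C) with hR
    have hRS : R ⊆ S := filter_subset _ _
    have hviol : ((violating U S C).card : ℝ) ≤ (1 / 2) ^ C.card * (models U R).card := by
      have h1 : (violating U R C).card * 2 ^ C.card ≤ (models U R).card :=
        card_violating_mul_le (hproper C hC) (subset_biUnion_of_mem vbl hC)
          fun D hD => (mem_filter.1 hD).2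
      have h2 : ((violating U R C).card : ℝ) * 2 ^ C.card ≤ (models U R).card := by
        exact_mod_cast h1
      have h3 : ((violating U S C).card : ℝ) ≤ (violating U R C).card := by
        exact_mod_cast card_le_card (violating_anti C hRS)
      rw [one_div, inv_pow, inv_mul_eq_div, le_div_iff₀ (by positivity)]
      exact (mul_le_mul_of_nonneg_right h3 (by positivity)).trans h2
    have hmodels : ((models U R).card : ℝ) ≤ 2 * (models U S).card := by
      rcases hRS.eq_or_ssubset with h | h
      · rw [h]
        linarith [Nat.cast_nonneg (α := ℝ) (models U S).card]
      have hle : ((models U R).card : ℝ) ≤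
          (models U S).card + ∑ D ∈ S \ R, ((violating U R D).card : ℝ) := by
        exact_mod_cast card_models_le_add_sum
      have hviol_sum : ∑ D ∈ S \ R, ((violating U R D).card : ℝ) ≤
          ∑ D ∈ S \ R, 2 * ((1 : ℝ) / 2) ^ D.card * ((models U R).card : ℝ) := by
        refine sum_le_sum fun D hD => ?_
        rw [mem_sdiff] at hD
        exact ih R h (hRS.trans hS) D (hS hD.1) hD.2
      have hsub : S \ R ⊆ Gamma F C := by
        intro D hD
        simp only [hR, mem_sdiff, mem_filter, not_and] at hD
        refine mem_filter.2 ⟨hS hD.1, ?_, ?_⟩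
        · rintro rfl
          exact hCS hD.1
        · exact not_disjoint_iff_nonempty_inter.1 (hD.2 hD.1)
      have hquarter : ∑ D ∈ S \ R, ((1 : ℝ) / 2) ^ D.card ≤ 1 / 4 :=
        (sum_le_sum_of_subset_of_nonneg hsub fun _ _ _ => by positivity).trans (hsum C hC)
      rw [← sum_mul, ← mul_sum] at hviol_sum
      nlinarith [Nat.cast_nonneg (α := ℝ) (models U R).card]
    have := mul_le_mul_of_nonneg_left hmodels (by positivity : (0 : ℝ) ≤ (1 / 2) ^ C.card)
    linarith

/-- The local lemma: if every clause has at least two literals and its neighbors have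
total weight at most `1/4`, the formula is satisfiable. -/
lemma not_unsat_of_sum_Gamma_le {F : CNF V} (hproper : ∀ C ∈ F, ProperClause C)
    (hcard : ∀ C ∈ F, 2 ≤ C.card)
    (hsum : ∀ C ∈ F, ∑ D ∈ Gamma F C, ((1 : ℝ) / 2) ^ D.card ≤ 1 / 4) : ¬ Unsat F := by
  have key : ∀ S : CNF V, S ⊆ F → 0 < (models (F.biUnion vbl) S).card := by
    intro S
    induction S using Finset.induction_on with
    | empty =>
      intro _
      exact card_pos.2 ⟨∅, mem_models.2 ⟨empty_subset _, by simp [Satisfies]⟩⟩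
    | insert C S hCS ih =>
      intro h
      have hC : C ∈ F := h (mem_insert_self _ _)
      have hSF : S ⊆ F := (subset_insert _ _).trans h
      have hpos : (0 : ℝ) < (models (F.biUnion vbl) S).card := by exact_mod_cast ih hSF
      have hviol := card_violating_le hproper hsum S hSF C hC hCS
      have hpow : ((1 : ℝ) / 2) ^ C.card ≤ 1 / 4 :=
        (pow_le_pow_of_le_one (by norm_num) (by norm_num) (hcard C hC)).trans (by norm_num)
      have hle := card_models_le_add_sum (U := F.biUnion vbl) (S := S) (T := insert C S)
      rw [insert_sdiff_cancel hCS, sum_singleton] at hle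
      have hle' : ((models (F.biUnion vbl) S).card : ℝ) ≤
          (models (F.biUnion vbl) (insert C S)).card +
            (violating (F.biUnion vbl) S C).card := by exact_mod_cast hle
      have : (0 : ℝ) < (models (F.biUnion vbl) (insert C S)).card := by nlinarith
      exact_mod_cast this
  obtain ⟨A, hA⟩ := card_pos.1 (key F subset_rfl)
  exact fun h => h _ (mem_models.1 hA).2

end Models

section Restriction

variable {V : Type} [DecidableEq V]

lemma degVar_le_degCNF (k : ℕ) (F : CNF V) (x : V) : degVar k F x ≤ degCNF k F := by
  by_cases hx : x ∈ F.biUnion vbl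
  · exact le_sup (f := degVar k F) hx
  · have : degVar k F x = 0 := by
      simp only [mem_biUnion, not_exists, not_and] at hx
      exact card_eq_zero.2 (filter_eq_empty_iff.2 fun D hD h => hx D hD h.1)
    omega

lemma eq_of_mem_vbl_of_ne {F : CNF V} (hlin : LinearCNF F) {C D : Clause V} (hC : C ∈ F)
    (hD : D ∈ F) {x y : V} (hxy : x ≠ y) (hxC : x ∈ vbl C) (hyC : y ∈ vbl C)
    (hxD : x ∈ vbl D) (hyD : y ∈ vbl D) : C = D := by
  by_contra h
  exact hxy (card_le_one.1 (hlin C hC D hD h) x (mem_inter.2 ⟨hxC, hxD⟩) y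
    (mem_inter.2 ⟨hyC, hyD⟩))

lemma card_le_card_filter_add_one {F : CNF V} (hlin : LinearCNF F) {C D : Clause V}
    (hC : C ∈ F) (hD : D ∈ F) (hCD : C ≠ D) (hproper : ProperClause D) {α : V → Option Bool}
    (hα : ∀ x, (α x).isSome ↔ x ∈ vbl C) :
    D.card ≤ (D.filter fun l => α l.1 ≠ some (!l.2)).card + 1 := by
  have hfalse : (D.filter fun l => ¬ α l.1 ≠ some (!l.2)).card ≤ (vbl C ∩ vbl D).card := by
    refine card_le_card_of_injOn Prod.fst (fun l hl => ?_) ?_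
    · simp only [mem_coe, mem_filter, not_not] at hl
      exact mem_inter.2 ⟨(hα _).1 (by simp [hl.2]), mem_image_of_mem _ hl.1⟩
    · exact (fst_injOn_of_properClause hproper).mono (coe_subset.2 (filter_subset _ _))
  have := hlin C hC D hD hCD
  rw [← card_filter_add_card_filter_not (s := D) (fun l => α l.1 ≠ some (!l.2))]
  omega

lemma degCNF_applyAssign_le {k : ℕ} {F : CNF V} (hlin : LinearCNF F) {C : Clause V}
    (hCk : C.card ≤ k) {α : V → Option Bool} (hα : ∀ x, (α x).isSome ↔ x ∈ vbl C) :
    degCNF k (applyAssign α F) ≤ degCNF k F + k := by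
  refine Finset.sup_le fun x _ => ?_
  by_cases hxC : x ∈ vbl C
  · have : degVar k (applyAssign α F) x = 0 := by
      refine card_eq_zero.2 (filter_eq_empty_iff.2 ?_)
      rintro D' hD' ⟨hx, -⟩
      obtain ⟨D, hD, rfl⟩ := mem_image.1 hD'
      obtain ⟨⟨y, b⟩, hl, rfl⟩ := mem_image.1 hx
      obtain ⟨hlD, hne⟩ := mem_filter.1 hl
      obtain ⟨c, hc⟩ := Option.isSome_iff_exists.1 ((hα _).2 hxC)
      have hne' : α y ≠ some b := fun h => (mem_filter.1 hD).2 ⟨_, hlD, h⟩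
      cases b <;> cases c <;> simp_all
    omega
  set small := F.filter fun D => x ∈ vbl D ∧ D.card ≤ k - 1
  set shrunk := (vbl C).biUnion fun y => F.filter fun D => x ∈ vbl D ∧ y ∈ vbl D
  have hsub : ((applyAssign α F).filter fun D => x ∈ vbl D ∧ D.card ≤ k - 1) ⊆
      (small ∪ shrunk).image fun D => D.filter fun l => α l.1 ≠ some (!l.2) := by
    intro D' hD'
    obtain ⟨hD', hx, hcard⟩ := mem_filter.1 hD'
    obtain ⟨D, hD, rfl⟩ := mem_image.1 hD'
    have hDF := (mem_filter.1 hD).1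
    have hxD : x ∈ vbl D := image_subset_image (filter_subset _ _) hx
    refine mem_image_of_mem _ ?_
    by_cases hall : ∀ l ∈ D, α l.1 ≠ some (!l.2)
    · rw [filter_true_of_mem hall] at hcard
      exact mem_union_left _ (mem_filter.2 ⟨hDF, hxD, hcard⟩)
    · push Not at hall
      obtain ⟨l, hl, hαl⟩ := hall
      refine mem_union_right _ (mem_biUnion.2 ⟨l.1, (hα _).1 (by simp [hαl]), ?_⟩)
      exact mem_filter.2 ⟨hDF, hxD, mem_image_of_mem _ hl⟩
  have hshrunk : shrunk.card ≤ C.card := by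
    refine (card_biUnion_le_card_mul _ _ 1 fun y hy => ?_).trans ?_
    · refine card_le_one.2 fun D hD E hE => ?_
      rw [mem_filter] at hD hE
      have hxy : x ≠ y := by
        rintro rfl
        exact hxC hy
      exact eq_of_mem_vbl_of_ne hlin hD.1 hE.1 hxy hD.2.1 hD.2.2 hE.2.1 hE.2.2
    · rw [mul_one]
      exact card_image_le
  have hsmall : small.card ≤ degCNF k F := degVar_le_degCNF k F x
  calc degVar k (applyAssign α F) x ≤ (small ∪ shrunk).card :=
        (card_le_card hsub).trans card_image_le
    _ ≤ small.card + shrunk.card := card_union_le _ _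
    _ ≤ degCNF k F + k := by omega

/-- The clauses of size `k` other than `C` that contain the variable `x`. -/
def fullNeighbors (k : ℕ) (F : CNF V) (C : Clause V) (x : V) : CNF V :=
  F.filter fun D => D ≠ C ∧ D.card = k ∧ x ∈ vbl D

lemma exists_sign_card_le (N : CNF V) (x : V) (hx : ∀ D ∈ N, x ∈ vbl D) :
    ∃ b : Bool, N.card ≤ 2 * (N.filter fun D => (x, b) ∈ D).card := by
  have hsub : N ⊆ (N.filter fun D => (x, true) ∈ D) ∪ N.filter fun D => (x, false) ∈ D := by
    intro D hD
    obtain ⟨⟨y, b⟩, hl, rfl⟩ := mem_image.1 (hx D hD)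
    cases b <;> simp_all
  have hcard := (card_le_card hsub).trans (card_union_le _ _)
  rcases le_total (N.filter fun D => (x, true) ∈ D).card
    (N.filter fun D => (x, false) ∈ D).card with h | h
  · exact ⟨false, by omega⟩
  · exact ⟨true, by omega⟩

lemma exists_assignment {k : ℕ} {F : CNF V} (hlin : LinearCNF F) {C : Clause V} (hC : C ∈ F)
    (hproper : ProperClause C) (hne : C.Nonempty) :
    ∃ α : V → Option Bool, (∀ x, (α x).isSome ↔ x ∈ vbl C) ∧ PSatClause α C ∧
      (C.card - 1 : ℝ) * ∑ x ∈ vbl C, ((fullNeighbors k F C x).card : ℝ) ≤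
        2 * C.card * ((F.filter fun D => PSatClause α D).card : ℝ) := by
  choose b hb using fun x => exists_sign_card_le (fullNeighbors k F C x) x
    fun D hD => (mem_filter.1 hD).2.2.2
  obtain ⟨x₀, hx₀, hmin⟩ := exists_min_image (vbl C) (fun x => (fullNeighbors k F C x).card)
    (hne.image _)
  obtain ⟨⟨y, b₀⟩, hl₀, rfl⟩ := mem_image.1 hx₀
  set α : V → Option Bool := fun x =>
    if x ∈ vbl C then some (if x = y then b₀ else b x) else none with hαdef
  refine ⟨α, fun x => ?_, ⟨_, hl₀, ?_⟩, ?_⟩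
  · by_cases hx : x ∈ vbl C <;> simp [hαdef, hx]
  · simp only at hx₀
    simp [hαdef, hx₀]
  simp only at hx₀ hmin
  set sat : V → CNF V := fun x => (fullNeighbors k F C x).filter fun D => (x, b x) ∈ D
  have hdisj : Set.PairwiseDisjoint ((vbl C).erase y : Set V) sat := by
    intro x hx z hz hxz
    refine Finset.disjoint_left.2 fun D hD hD' => ?_
    have h1 := (mem_filter.1 (mem_filter.1 hD).1).2
    have h2 := (mem_filter.1 (mem_filter.1 hD').1).2
    exact h1.1 (eq_of_mem_vbl_of_ne hlin hC (mem_filter.1 (mem_filter.1 hD).1).1 hxz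
      (mem_of_mem_erase hx) (mem_of_mem_erase hz) h1.2.2 h2.2.2).symm
  have hsub : ((vbl C).erase y).biUnion sat ⊆ F.filter fun D => PSatClause α D := by
    intro D hD
    obtain ⟨x, hx, hD⟩ := mem_biUnion.1 hD
    obtain ⟨hxy, hxC⟩ := mem_erase.1 hx
    obtain ⟨hDN, hxD⟩ := mem_filter.1 hD
    exact mem_filter.2 ⟨(mem_filter.1 hDN).1, _, hxD, by simp [hαdef, hxC, hxy]⟩
  have hcount : ∑ x ∈ (vbl C).erase y, (fullNeighbors k F C x).card ≤
      2 * (F.filter fun D => PSatClause α D).card := by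
    calc _ ≤ ∑ x ∈ (vbl C).erase y, 2 * (sat x).card := sum_le_sum fun x _ => hb x
      _ = 2 * (((vbl C).erase y).biUnion sat).card := by rw [card_biUnion hdisj, mul_sum]
      _ ≤ _ := by gcongr
  have hsum : ∑ x ∈ vbl C, ((fullNeighbors k F C x).card : ℝ) =
      (fullNeighbors k F C y).card +
        ∑ x ∈ (vbl C).erase y, ((fullNeighbors k F C x).card : ℝ) :=
    (add_sum_erase _ _ hx₀).symm
  have hmin' : (C.card : ℝ) * (fullNeighbors k F C y).card ≤
      ∑ x ∈ vbl C, ((fullNeighbors k F C x).card : ℝ) := by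
    have := card_nsmul_le_sum (vbl C) (fun x => (fullNeighbors k F C x).card) _ hmin
    rw [card_vbl hproper, smul_eq_mul] at this
    exact_mod_cast this
  have hcount' : ∑ x ∈ (vbl C).erase y, ((fullNeighbors k F C x).card : ℝ) ≤
      2 * (F.filter fun D => PSatClause α D).card := by exact_mod_cast hcount
  have := mul_le_mul_of_nonneg_left hcount' (Nat.cast_nonneg (α := ℝ) C.card)
  rw [hsum] at hmin' ⊢
  linarith

lemma sum_Gamma_le {k l : ℕ} {F : CNF V} {C : Clause V}
    (hC : C.card ≤ k) (hbounds : ∀ D ∈ F, l ≤ D.card ∧ D.card ≤ k) :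
    ∑ D ∈ Gamma F C, ((1 : ℝ) / 2) ^ D.card ≤
      k * degCNF k F * (1 / 2) ^ l +
        (∑ x ∈ vbl C, ((fullNeighbors k F C x).card : ℝ)) * (1 / 2) ^ k := by
  rw [← sum_filter_add_sum_filter_not (Gamma F C) fun D => D.card ≤ k - 1]
  refine add_le_add ?_ ?_
  · have hcard : ((Gamma F C).filter fun D => D.card ≤ k - 1).card ≤ k * degCNF k F := by
      have hsub : ((Gamma F C).filter fun D => D.card ≤ k - 1) ⊆
          (vbl C).biUnion fun x => F.filter fun D => x ∈ vbl D ∧ D.card ≤ k - 1 := by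
        intro D hD
        obtain ⟨hD, hDk⟩ := mem_filter.1 hD
        obtain ⟨hDF, -, x, hx⟩ := mem_filter.1 hD
        rw [mem_inter] at hx
        exact mem_biUnion.2 ⟨x, hx.2, mem_filter.2 ⟨hDF, hx.1, hDk⟩⟩
      refine (card_le_card hsub).trans ((card_biUnion_le_card_mul _ _ (degCNF k F)
        fun x _ => degVar_le_degCNF k F x).trans ?_)
      gcongr
      exact card_image_le.trans hC
    have hcard' : (((Gamma F C).filter fun D => D.card ≤ k - 1).card : ℝ) ≤
        k * degCNF k F := by exact_mod_cast hcard
    refine (sum_le_card_nsmul _ _ (((1 : ℝ) / 2) ^ l) fun D hD => ?_).trans ?_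
    · exact pow_le_pow_of_le_one (by norm_num) (by norm_num)
        (hbounds D (mem_filter.1 (mem_filter.1 hD).1).1).1
    · rw [nsmul_eq_mul]
      gcongr
  · have hfull : ∀ D ∈ (Gamma F C).filter (fun D => ¬ D.card ≤ k - 1), D.card = k := by
      intro D hD
      obtain ⟨hD, hDk⟩ := mem_filter.1 hD
      have := hbounds D (mem_filter.1 hD).1
      omega
    have hsub : ((Gamma F C).filter fun D => ¬ D.card ≤ k - 1) ⊆
        (vbl C).biUnion (fullNeighbors k F C) := by
      intro D hD
      obtain ⟨hDF, hne, x, hx⟩ := mem_filter.1 (mem_filter.1 hD).1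
      rw [mem_inter] at hx
      exact mem_biUnion.2 ⟨x, hx.2, mem_filter.2 ⟨hDF, hne, hfull D hD, hx.1⟩⟩
    have hcard : (((Gamma F C).filter fun D => ¬ D.card ≤ k - 1).card : ℝ) ≤
        ∑ x ∈ vbl C, ((fullNeighbors k F C x).card : ℝ) := by
      exact_mod_cast (card_le_card hsub).trans card_biUnion_le
    rw [sum_congr rfl fun D hD => by rw [hfull D hD], sum_const, nsmul_eq_mul]
    gcongr

end Restriction

/-- Fix `k` and let `F` be an unsatisfiable linear `[l,k]`-CNF with
`2 ≤ l ≤ k`. Then there exist a clause `C ∈ F` and a partial assignment `α` defined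
exactly on the variables of `C` such that `F^[α]` is an `[l-1,k]`-CNF,
`d(F^[α]) ≤ d(F) + k`, and `α` satisfies at least
`((l-1)/(2l))·(2^{k-2} - k·d(F)·2^{k-l})` clauses of `F`. -/
theorem good_partial_assignment_exists (k l : ℕ) (hl : 2 ≤ l) (hlk : l ≤ k)
    (V : Type) [DecidableEq V] (F : CNF V)
    (hproper : ∀ C ∈ F, ProperClause C)
    (hlin : LinearCNF F)
    (hbounds : ∀ C ∈ F, l ≤ C.card ∧ C.card ≤ k)
    (hunsat : Unsat F) :
    ∃ C ∈ F, ∃ α : V → Option Bool,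
      (∀ x : V, (α x).isSome ↔ x ∈ vbl C) ∧
      (∀ D ∈ applyAssign α F, l - 1 ≤ D.card ∧ D.card ≤ k) ∧
      degCNF k (applyAssign α F) ≤ degCNF k F + k ∧
      (((l : ℝ) - 1) / (2 * l)) *
          ((2 : ℝ) ^ (k - 2) - (k : ℝ) * degCNF k F * 2 ^ (k - l)) ≤
        ((F.filter fun D => PSatClause α D).card : ℝ) := by
  obtain ⟨C, hC, hweight⟩ : ∃ C ∈ F, 1 / 4 < ∑ D ∈ Gamma F C, ((1 : ℝ) / 2) ^ D.card := by
    by_contra! h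
    exact not_unsat_of_sum_Gamma_le hproper (fun C hC => hl.trans (hbounds C hC).1) h hunsat
  obtain ⟨hlC, hCk⟩ := hbounds C hC
  obtain ⟨α, hα, hsat, hcount⟩ := exists_assignment (k := k) hlin hC (hproper C hC)
    (card_pos.1 (by omega))
  refine ⟨C, hC, α, hα, fun D' hD' => ?_, degCNF_applyAssign_le hlin hCk hα, ?_⟩
  · obtain ⟨D, hD, rfl⟩ := mem_image.1 hD'
    obtain ⟨hDF, hDα⟩ := mem_filter.1 hD
    have hCD : C ≠ D := by
      rintro rfl
      exact hDα hsat
    have hshrink := card_le_card_filter_add_one hlin hC hDF hCD (hproper D hDF) hα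
    have := hbounds D hDF
    exact ⟨by omega, (card_filter_le _ _).trans this.2⟩
  have hweight := hweight.trans_le (sum_Gamma_le hCk hbounds)
  set N := ∑ x ∈ vbl C, ((fullNeighbors k F C x).card : ℝ)
  set s := ((F.filter fun D => PSatClause α D).card : ℝ)
  have hN0 : 0 ≤ N := sum_nonneg fun _ _ => Nat.cast_nonneg _
  have hpow (m : ℕ) (hm : m ≤ k) : (2 : ℝ) ^ (k - m) = 2 ^ k * (1 / 2) ^ m := by
    rw [pow_sub₀ _ two_ne_zero hm, one_div, inv_pow]
  have hfull : (2 : ℝ) ^ (k - 2) - k * degCNF k F * 2 ^ (k - l) ≤ N := by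
    rw [hpow 2 (hl.trans hlk), hpow l hlk]
    have hmul := mul_le_mul_of_nonneg_left hweight.le (by positivity : (0 : ℝ) ≤ 2 ^ k)
    have hone : (2 : ℝ) ^ k * (1 / 2) ^ k = 1 := by rw [← mul_pow]; norm_num
    linear_combination hmul + N * hone
  have hl' : (2 : ℝ) ≤ l := by exact_mod_cast hl
  have hlC' : (l : ℝ) ≤ C.card := by exact_mod_cast hlC
  refine (mul_le_mul_of_nonneg_left hfull (div_nonneg (by linarith) (by linarith))).trans ?_
  have hratio : ((l : ℝ) - 1) / (2 * l) ≤ (C.card - 1) / (2 * C.card) := by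
    rw [div_le_div_iff₀ (by linarith) (by linarith)]
    linarith
  refine (mul_le_mul_of_nonneg_right hratio hN0).trans ?_
  rw [div_mul_eq_mul_div, div_le_iff₀ (by linarith)]
  linarith
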